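/- arXiv:2508.18247 — 2 statements merged into one kernel-verified Lean document; each statement's English description precedes it below -/
import Mathlib

section
/- Let Λ ⊆ ℂ be a lattice and let s ∈ ℂ satisfy ns ∉ Λ for every integer n ≥ 1. For every integer k ≥ 2, the (k−1)-st derivative ζ_Λ^{(k−1)} is an elliptic function for Λ and is not elliptically summable. In particular ℘_Λ = −ζ_Λ' and ℘_Λ' = −ζ_Λ'' are not elliptically summable. -/
open Filter Topology Set

/-- The Weierstrass zeta function of a lattice `L ⊆ ℂ`. -/
noncomputable def wzeta (L : Set ℂ) (z : ℂ) : ℂ :=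
  1 / z + ∑' l : ↥(L \ {0}), (1 / (z - (l : ℂ)) + 1 / (l : ℂ) + z / (l : ℂ) ^ 2)

/-- `L` is a lattice in `ℂ`. -/
def IsLattice (L : Set ℂ) : Prop :=
  ∃ ω₁ ω₂ : ℂ, LinearIndependent ℝ ![ω₁, ω₂] ∧
    L = {z : ℂ | ∃ m n : ℤ, z = (m : ℂ) * ω₁ + (n : ℂ) * ω₂}

/-- `F` extends analytically to the point `α`. -/
def ExtAnalyticAt (F : ℂ → ℂ) (α : ℂ) : Prop :=
  ∃ g : ℂ → ℂ, AnalyticAt ℂ g α ∧ ∀ᶠ z in 𝓝[≠] α, F z = g z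

/-- `f` is an elliptic function for the lattice `L`: meromorphic on `ℂ` and `L`-periodic. -/
def IsElliptic (L : Set ℂ) (f : ℂ → ℂ) : Prop :=
  MeromorphicOn f Set.univ ∧
    ∀ lam ∈ L, ∀ z : ℂ, AnalyticAt ℂ f z → f (z + lam) = f z

/-- `c : ℕ → ℂ` is the family of principal part coefficients of `f` at `α`
(`c k` is the coefficient of `1/(z-α)^k`; `c 0` is irrelevant and set to `0`). -/
def IsPrincPart (f : ℂ → ℂ) (α : ℂ) (c : ℕ → ℂ) : Prop :=
  c 0 = 0 ∧ (Function.support c).Finite ∧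
    ExtAnalyticAt (fun z => f z - ∑ᶠ k : ℕ, c k / (z - α) ^ k) α

/-- `R` is a pinning: `(r, n, λ) ↦ r + n s + λ` is a bijection from `R × ℤ × L` onto `ℂ`. -/
def IsPinning (L : Set ℂ) (s : ℂ) (R : Set ℂ) : Prop :=
  ∀ z : ℂ, ∃! p : ℂ × ℤ × ℂ, p.1 ∈ R ∧ p.2.2 ∈ L ∧ z = p.1 + (p.2.1 : ℂ) * s + p.2.2


/-- `f` is elliptically summable: `f = τ(g) − g` for some elliptic `g`,
where `τ(g)(z) = g(z+s)`. -/
def EllSummable (L : Set ℂ) (s : ℂ) (f : ℂ → ℂ) : Prop :=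
  ∃ g : ℂ → ℂ, IsElliptic L g ∧
    ∀ z : ℂ, AnalyticAt ℂ g z → AnalyticAt ℂ g (z + s) → f z = g (z + s) - g z

lemma PeriodPair.false_of_periodic_of_mem_multiples (L : PeriodPair) {P : Set ℂ}
    (hP : ∀ x, ∀ᶠ y in 𝓝[≠] x, y ∉ P) (hper : ∀ l ∈ L.lattice, ∀ z ∈ P, z - l ∈ P)
    {t : ℂ} (ht : ∀ n : ℕ, 1 ≤ n → (n : ℂ) * t ∉ L.lattice)
    (hmem : ∀ n : ℕ, ((n : ℂ) + 1) * t ∈ P) : False := by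
  let u : ℕ → ℂ := fun n ↦ ZSpan.fract L.basis (((n : ℂ) + 1) * t)
  have hne : ∀ m n : ℕ, m < n → u m ≠ u n := by
    intro m n hmn h
    rw [ZSpan.fract_eq_fract, ← L.lattice_eq_span_range_basis] at h
    apply ht (n - m) (by omega)
    convert h using 1
    push_cast [hmn.le]
    ring
  have hinj : Function.Injective u := by
    intro m n h
    rcases lt_trichotomy m n with h' | h' | h'
    · exact absurd h (hne m n h')
    · exact h'
    · exact absurd h.symm (hne n m h')
  have hu : ∀ n, u n ∈ P := fun n ↦ by
    refine hper _ ?_ _ (hmem n)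
    rw [L.lattice_eq_span_range_basis]
    exact (ZSpan.floor L.basis _).2
  obtain ⟨x, -, hx⟩ := (Set.infinite_range_of_injective hinj).exists_accPt_of_subset_isCompact
    (isCompact_closedBall (0 : ℂ) (∑ i, ‖L.basis i‖)) (by
      rintro _ ⟨n, rfl⟩
      simpa using ZSpan.norm_fract_le L.basis (((n : ℂ) + 1) * t))
  rw [accPt_iff_frequently_nhdsNE] at hx
  exact hx ((hP x).mono fun y hy ⟨n, hn⟩ ↦ hy (hn ▸ hu n))

lemma MeromorphicOn.eventually_analyticAt_add {g : ℂ → ℂ} (hg : MeromorphicOn g Set.univ)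
    (c x : ℂ) : ∀ᶠ z in 𝓝[≠] x, AnalyticAt ℂ g (z + c) := by
  have h := (hg (x + c) (mem_univ _)).eventually_analyticAt
  refine Tendsto.eventually (f := fun z ↦ z + c) ?_ h
  refine tendsto_nhdsWithin_iff.mpr ⟨?_, ?_⟩
  · exact ((continuous_add_const c).tendsto x).mono_left nhdsWithin_le_nhds
  · filter_upwards [self_mem_nhdsWithin] with z hz
    simpa using hz

lemma IsElliptic.meromorphicOrderAt_add {L : Set ℂ} {g : ℂ → ℂ} (hg : IsElliptic L g)
    {l : ℂ} (hl : l ∈ L) (z : ℂ) :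
    meromorphicOrderAt g (z + l) = meromorphicOrderAt g z := by
  rw [← meromorphicOrderAt_fun_comp_add_const_eq_meromorphicOrderAt]
  refine meromorphicOrderAt_congr ?_
  filter_upwards [(hg.1 z (mem_univ _)).eventually_analyticAt] with w hw
  exact hg.2 l hl w hw

lemma PeriodPair.not_ellSummable (L : PeriodPair) {s : ℂ}
    (hs : ∀ n : ℕ, 1 ≤ n → (n : ℂ) * s ∉ L.lattice) {f : ℂ → ℂ}
    (hf : ∀ z ∉ L.lattice, AnalyticAt ℂ f z) (h0 : meromorphicOrderAt f 0 < 0) :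
    ¬ EllSummable L.lattice s f := by
  rintro ⟨g, hg, hgf⟩
  have hgm (z : ℂ) : MeromorphicAt g z := hg.1 z (mem_univ _)
  have hgsm (z : ℂ) : MeromorphicAt (fun w ↦ g (w + s)) z := by
    have := hgm (z + s)
    fun_prop
  have hev (z : ℂ) : f =ᶠ[𝓝[≠] z] fun w ↦ g (w + s) - g w := by
    filter_upwards [(hgm z).eventually_analyticAt, hg.1.eventually_analyticAt_add s z] with w h1 h2
    exact hgf w h1 h2
  have hord (z : ℂ) : meromorphicOrderAt (fun w ↦ g (w + s)) z = meromorphicOrderAt g (z + s) :=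
    meromorphicOrderAt_fun_comp_add_const_eq_meromorphicOrderAt
  have hnn {z : ℂ} (hz : z ∉ L.lattice) : 0 ≤ meromorphicOrderAt f z :=
    (hf z hz).meromorphicOrderAt_nonneg
  have hiso (x : ℂ) : ∀ᶠ y in 𝓝[≠] x, y ∉ {z | meromorphicOrderAt g z < 0} := by
    filter_upwards [(hgm x).eventually_analyticAt] with y hy
    simpa using hy.meromorphicOrderAt_nonneg
  have hper : ∀ l ∈ L.lattice, ∀ z ∈ {z | meromorphicOrderAt g z < 0},
      z - l ∈ {z | meromorphicOrderAt g z < 0} := by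
    intro l hl z hz
    have := hg.meromorphicOrderAt_add hl (z - l)
    rw [sub_add_cancel] at this
    simpa [← this] using hz
  have hfm (z : ℂ) : MeromorphicAt f z := ((hgsm z).sub (hgm z)).congr (hev z).symm
  -- a pole propagates along the orbit of `s` as long as `f` is regular
  have hstep {z : ℂ} (hz : z ∉ L.lattice) :
      meromorphicOrderAt g z < 0 ↔ meromorphicOrderAt g (z + s) < 0 := by
    constructor
    · intro h
      by_contra! h'
      have hge : g =ᶠ[𝓝[≠] z] (fun w ↦ g (w + s)) + -f := by
        filter_upwards [hev z] with w hw
        simp [hw]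
      have := meromorphicOrderAt_add (hgsm z) (hfm z).neg
      rw [← meromorphicOrderAt_congr hge, ← meromorphicOrderAt_neg, hord] at this
      exact absurd h (not_lt.mpr ((le_min h' (hnn hz)).trans this))
    · intro h
      by_contra! h'
      have hge : (fun w ↦ g (w + s)) =ᶠ[𝓝[≠] z] g + f := by
        filter_upwards [hev z] with w hw
        simp [hw]
      have := meromorphicOrderAt_add (hgm z) (hfm z)
      rw [← meromorphicOrderAt_congr hge, hord] at this
      exact absurd h (not_lt.mpr ((le_min h' (hnn hz)).trans this))
  have hpole : meromorphicOrderAt g s < 0 ∨ meromorphicOrderAt g 0 < 0 := by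
    by_contra! h
    have hge : f =ᶠ[𝓝[≠] 0] (fun w ↦ g (w + s)) + -g := by
      filter_upwards [hev 0] with w hw
      simp [hw, sub_eq_add_neg]
    have := meromorphicOrderAt_add (hgsm 0) (hgm 0).neg
    rw [← meromorphicOrderAt_congr hge, ← meromorphicOrderAt_neg, hord, zero_add] at this
    exact absurd h0 (not_lt.mpr ((le_min h.1 h.2).trans this))
  rcases hpole with h | h
  · refine L.false_of_periodic_of_mem_multiples hiso hper hs fun n ↦ ?_
    induction n with
    | zero => simpa using h
    | succ n ih =>
      have := (hstep (by exact_mod_cast hs (n + 1) (by omega))).mp ih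
      simp only [mem_ofPred_eq] at ih ⊢
      convert this using 2
      push_cast
      ring
  · have hs' : ∀ n : ℕ, 1 ≤ n → (n : ℂ) * (-s) ∉ L.lattice := by
      intro n hn hmem
      exact hs n hn (by simpa using neg_mem hmem)
    refine L.false_of_periodic_of_mem_multiples hiso hper hs' fun n ↦ ?_
    induction n with
    | zero =>
      have := (hstep (z := -s) (by simpa using hs' 1 le_rfl)).mpr (by simpa using h)
      simpa using this
    | succ n ih =>
      refine (hstep (by exact_mod_cast hs' (n + 2) (by omega))).mpr ?_
      simp only [mem_ofPred_eq] at ih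
      convert ih using 2
      push_cast
      ring

lemma norm_wzeta_summand_le {r : ℝ} (hr : 0 < r) {z : ℂ} (hz : ‖z‖ < r) {l : ℂ}
    (h : 2 * r ≤ ‖l‖) :
    ‖1 / (z - l) + 1 / l + z / l ^ 2‖ ≤ 2 * r ^ 2 * ‖l‖ ^ (-3 : ℝ) := by
  have hl : 0 < ‖l‖ := by linarith
  have hzl : ‖l‖ / 2 ≤ ‖z - l‖ := by
    rw [norm_sub_rev]
    exact .trans (by linarith) (norm_sub_norm_le l z)
  have hl0 : l ≠ 0 := norm_pos_iff.mp hl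
  have hzl0 : z - l ≠ 0 := norm_pos_iff.mp (by linarith)
  calc
    _ = ‖z ^ 2 / ((z - l) * l ^ 2)‖ := by
      congr 1
      field_simp
      ring
    _ = ‖z‖ ^ 2 / (‖z - l‖ * ‖l‖ ^ 2) := by simp
    _ ≤ r ^ 2 / (‖l‖ / 2 * ‖l‖ ^ 2) := by gcongr
    _ = 2 * r ^ 2 / ‖l‖ ^ 3 := by field
    _ = _ := by norm_cast

lemma PeriodPair.hasSumLocallyUniformly_wzeta (L : PeriodPair) :
    HasSumLocallyUniformly
      (fun (l : L.lattice) (z : ℂ) ↦ 1 / (z - l) + 1 / (l : ℂ) + z / (l : ℂ) ^ 2)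
      (fun z ↦ ∑' l : L.lattice, (1 / (z - l) + 1 / (l : ℂ) + z / (l : ℂ) ^ 2)) := by
  refine L.hasSumLocallyUniformly_aux (u := (2 * · ^ 2 * ‖·‖ ^ (-3 : ℝ))) _
    (fun _ _ ↦ (ZLattice.summable_norm_rpow _ _ (by simp; norm_num)).mul_left _) fun r hr ↦
    Filter.eventually_atTop.mpr ⟨2 * r, ?_⟩
  rintro _ h s hs l rfl
  exact norm_wzeta_summand_le hr hs h

lemma PeriodPair.wzeta_eq_tsum (L : PeriodPair) (z : ℂ) :
    wzeta L.lattice z = ∑' l : L.lattice, (1 / (z - l) + 1 / (l : ℂ) + z / (l : ℂ) ^ 2) := by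
  rw [(L.hasSumLocallyUniformly_wzeta.hasSum (x := z)).summable.tsum_eq_add_tsum_ite 0]
  simp only [wzeta]
  congr 1
  · simp
  have h := tsum_subtype ((L.lattice : Set ℂ) \ {0})
    (fun l : ℂ ↦ 1 / (z - l) + 1 / l + z / l ^ 2)
  rw [h, ← tsum_subtype_eq_of_support_subset (s := (L.lattice : Set ℂ))]
  · refine tsum_congr fun l ↦ ?_
    by_cases hl : l = 0
    · simp [hl]
    · have hl' : (l : ℂ) ∈ (L.lattice : Set ℂ) \ {0} := ⟨l.2, by simpa using! hl⟩
      rw [indicator_of_mem hl', if_neg hl]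
  · intro x hx
    by_contra hx'
    simp_all

lemma PeriodPair.eqOn_deriv_wzeta (L : PeriodPair) :
    EqOn (deriv (wzeta L.lattice)) (fun z ↦ -L.weierstrassP z) (L.lattice : Set ℂ)ᶜ := by
  have hne {z : ℂ} (hz : z ∈ (L.lattice : Set ℂ)ᶜ) (l : L.lattice) : z - l ≠ 0 := by
    intro e
    exact hz (sub_eq_zero.mp e ▸ l.2)
  rw [funext L.wzeta_eq_tsum]
  refine (L.hasSumLocallyUniformly_wzeta.tendstoLocallyUniformlyOn.deriv
    (.of_forall fun s ↦ ?_) L.isClosed_lattice.isOpen_compl).unique ?_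
  · refine .fun_sum fun i hi ↦ ?_
    exact .add (.add (.div (by fun_prop) (by fun_prop) fun x hx ↦ hne hx i) (by fun_prop))
      (by fun_prop)
  · have := L.hasSumLocallyUniformly_weierstrassP.tendstoLocallyUniformlyOn
      (s := (L.lattice : Set ℂ)ᶜ)
    refine TendstoLocallyUniformlyOn.congr this.neg ?_
    intro s z hz
    simp only [Function.comp_apply, Pi.neg_apply]
    rw [deriv_fun_sum, ← Finset.sum_neg_distrib]
    · congr with l
      have h := hne hz l
      have h1 : HasDerivAt (fun w : ℂ ↦ 1 / (w - l) + 1 / (l : ℂ) + w / (l : ℂ) ^ 2)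
          (-1 / (z - l) ^ 2 + 1 / (l : ℂ) ^ 2) z := by
        simpa only [one_div] using! ((((hasDerivAt_id z).sub_const (l : ℂ)).inv h).add_const
          ((l : ℂ)⁻¹)).add ((hasDerivAt_id z).div_const ((l : ℂ) ^ 2))
      rw [h1.deriv]
      ring
    · intro l hl
      have h := hne hz l
      fun_prop (disch := assumption)

lemma PeriodPair.analyticAt_iteratedDeriv_wzeta (L : PeriodPair) (n : ℕ) {z : ℂ}
    (hz : z ∉ L.lattice) : AnalyticAt ℂ (iteratedDeriv (n + 1) (wzeta L.lattice)) z := by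
  have hU : (L.lattice : Set ℂ)ᶜ ∈ 𝓝 z := L.isClosed_lattice.isOpen_compl.mem_nhds hz
  induction n with
  | zero =>
    rw [zero_add, iteratedDeriv_one]
    refine (L.analyticOnNhd_weierstrassP z hz).neg.congr ?_
    filter_upwards [hU] with w hw using (L.eqOn_deriv_wzeta hw).symm
  | succ n ih =>
    rw [iteratedDeriv_succ]
    exact ih.deriv

lemma PeriodPair.meromorphicOrderAt_iteratedDeriv_wzeta (L : PeriodPair) (n : ℕ) {l : ℂ}
    (hl : l ∈ L.lattice) :
    meromorphicOrderAt (iteratedDeriv (n + 1) (wzeta L.lattice)) l = ((-(n : ℤ) - 2 : ℤ)) := by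
  induction n with
  | zero =>
    rw [zero_add, iteratedDeriv_one, meromorphicOrderAt_congr (f₂ := fun z ↦ -L.weierstrassP z),
      ← meromorphicOrderAt_fun_neg, L.order_weierstrassP l hl]
    · rfl
    filter_upwards [self_mem_nhdsWithin, mem_nhdsWithin_of_mem_nhds
      (L.compl_lattice_sdiff_singleton_mem_nhds l)] with w hw hw'
    exact L.eqOn_deriv_wzeta fun h ↦ hw' ⟨h, hw⟩
  | succ n ih =>
    rw [iteratedDeriv_succ, meromorphicOrderAt_deriv_eq_sub_one _ ih]
    · congr 1
      push_cast
      ring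
    · exact_mod_cast (by omega : (-(n : ℤ) - 2) ≠ 0)

lemma PeriodPair.iteratedDeriv_wzeta_add (L : PeriodPair) (n : ℕ) {l z : ℂ}
    (hl : l ∈ L.lattice) (hz : z ∉ L.lattice) :
    iteratedDeriv (n + 1) (wzeta L.lattice) (z + l) =
      iteratedDeriv (n + 1) (wzeta L.lattice) z := by
  induction n generalizing z with
  | zero =>
    have hzl : z + l ∉ L.lattice := fun h ↦ hz (by simpa using sub_mem h hl)
    rw [zero_add, iteratedDeriv_one, L.eqOn_deriv_wzeta hz, L.eqOn_deriv_wzeta hzl]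
    exact congrArg Neg.neg (L.weierstrassP_add_coe z ⟨l, hl⟩)
  | succ n ih =>
    rw [iteratedDeriv_succ, ← deriv_comp_add_const]
    refine EventuallyEq.deriv_eq ?_
    filter_upwards [L.isClosed_lattice.isOpen_compl.mem_nhds hz] with w hw using ih hw

lemma PeriodPair.isElliptic_iteratedDeriv_wzeta (L : PeriodPair) (n : ℕ) :
    IsElliptic L.lattice (iteratedDeriv (n + 1) (wzeta L.lattice)) := by
  refine ⟨fun z _ ↦ ?_, fun l hl z hz ↦ L.iteratedDeriv_wzeta_add n hl fun hzL ↦ ?_⟩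
  · by_cases hz : z ∈ L.lattice
    · refine meromorphicAt_of_meromorphicOrderAt_ne_zero ?_
      rw [L.meromorphicOrderAt_iteratedDeriv_wzeta n hz]
      exact_mod_cast (by omega : (-(n : ℤ) - 2) ≠ 0)
    · exact (L.analyticAt_iteratedDeriv_wzeta n hz).meromorphicAt
  · have := hz.meromorphicOrderAt_nonneg
    rw [L.meromorphicOrderAt_iteratedDeriv_wzeta n hzL] at this
    have : (0 : ℤ) ≤ -(n : ℤ) - 2 := by exact_mod_cast this
    omega

lemma PeriodPair.meromorphicOrderAt_iteratedDeriv_wzeta_zero_neg (L : PeriodPair) (n : ℕ) :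
    meromorphicOrderAt (iteratedDeriv (n + 1) (wzeta L.lattice)) 0 < 0 := by
  rw [L.meromorphicOrderAt_iteratedDeriv_wzeta n (zero_mem _)]
  exact_mod_cast (by omega : (-(n : ℤ) - 2) < 0)

theorem stmt7 (L : Set ℂ) (hL : IsLattice L) (s : ℂ)
    (hs : ∀ n : ℕ, 1 ≤ n → (n : ℂ) * s ∉ L) :
    (∀ k : ℕ, 2 ≤ k →
      IsElliptic L (iteratedDeriv (k - 1) (wzeta L)) ∧
      ¬ EllSummable L s (iteratedDeriv (k - 1) (wzeta L))) ∧
    ¬ EllSummable L s (fun z => -(deriv (wzeta L) z)) ∧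
    ¬ EllSummable L s (fun z => -(iteratedDeriv 2 (wzeta L) z)) := by
  obtain ⟨ω₁, ω₂, hω, rfl⟩ := hL
  let Λ : PeriodPair := ⟨ω₁, ω₂, hω⟩
  have hΛ : {z : ℂ | ∃ m n : ℤ, z = (m : ℂ) * ω₁ + (n : ℂ) * ω₂} = Λ.lattice := by
    ext z
    simp [PeriodPair.mem_lattice, Λ, eq_comm]
  rw [hΛ] at hs ⊢
  have hneg (n : ℕ) :
      ¬ EllSummable Λ.lattice s (fun z ↦ -(iteratedDeriv (n + 1) (wzeta Λ.lattice) z)) := by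
    refine Λ.not_ellSummable hs (fun z hz ↦ (Λ.analyticAt_iteratedDeriv_wzeta n hz).neg) ?_
    rw [← meromorphicOrderAt_fun_neg]
    exact Λ.meromorphicOrderAt_iteratedDeriv_wzeta_zero_neg n
  refine ⟨fun k hk ↦ ?_, ?_, hneg 1⟩
  · obtain ⟨n, rfl⟩ : ∃ n, k = n + 2 := ⟨k - 2, by omega⟩
    exact ⟨Λ.isElliptic_iteratedDeriv_wzeta n,
      Λ.not_ellSummable hs (fun z hz ↦ Λ.analyticAt_iteratedDeriv_wzeta n hz)
        (Λ.meromorphicOrderAt_iteratedDeriv_wzeta_zero_neg n)⟩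
  · simpa only [zero_add, iteratedDeriv_one] using hneg 0
end

section
/- Let Λ ⊆ ℂ be a lattice, let s ∈ ℂ satisfy ns ∉ Λ for every integer n ≥ 1, and let f be an elliptic function for Λ that is elliptically summable. If f has a pole at some point z₀ ∈ ℂ (i.e. c_k(f,z₀) ≠ 0 for some k ≥ 1), then there exist n ∈ ℤ and λ ∈ Λ such that z₁ := z₀ + ns + λ ∉ z₀ + Λ and f has a pole at z₁. (Equivalently: in each orbit of translations by Λ and s, the set of poles of f occupies either no Λ-coset or at least two distinct Λ-cosets.) -/
open Filter Topology Set

section ExtAnalytic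

theorem tendsto_add_const_punctured (α t : ℂ) :
    Tendsto (fun z : ℂ => z + t) (𝓝[≠] α) (𝓝[≠] (α + t)) := by
  refine tendsto_nhdsWithin_iff.mpr ⟨?_, ?_⟩
  · exact ((continuous_id.add continuous_const).tendsto α).mono_left nhdsWithin_le_nhds
  · filter_upwards [self_mem_nhdsWithin] with z hz
    exact fun h => hz (add_right_cancel h)

theorem ExtAnalyticAt.congr {F G : ℂ → ℂ} {α : ℂ} (h : ExtAnalyticAt F α)
    (hFG : ∀ᶠ z in 𝓝[≠] α, G z = F z) : ExtAnalyticAt G α := by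
  obtain ⟨u, hu, hFu⟩ := h
  refine ⟨u, hu, ?_⟩
  filter_upwards [hFu, hFG] with z h₁ h₂
  rw [h₂, h₁]

theorem ExtAnalyticAt.sub {F G : ℂ → ℂ} {α : ℂ} (hF : ExtAnalyticAt F α)
    (hG : ExtAnalyticAt G α) : ExtAnalyticAt (fun z => F z - G z) α := by
  obtain ⟨u, hu, hFu⟩ := hF
  obtain ⟨v, hv, hGv⟩ := hG
  refine ⟨fun z => u z - v z, hu.sub hv, ?_⟩
  filter_upwards [hFu, hGv] with z h₁ h₂
  rw [h₁, h₂]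

theorem ExtAnalyticAt.add {F G : ℂ → ℂ} {α : ℂ} (hF : ExtAnalyticAt F α)
    (hG : ExtAnalyticAt G α) : ExtAnalyticAt (fun z => F z + G z) α := by
  obtain ⟨u, hu, hFu⟩ := hF
  obtain ⟨v, hv, hGv⟩ := hG
  refine ⟨fun z => u z + v z, hu.add hv, ?_⟩
  filter_upwards [hFu, hGv] with z h₁ h₂
  rw [h₁, h₂]

theorem ExtAnalyticAt.comp_add_const {F : ℂ → ℂ} {α t : ℂ} (h : ExtAnalyticAt F (α + t)) :
    ExtAnalyticAt (fun z => F (z + t)) α := by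
  obtain ⟨u, hu, hFu⟩ := h
  refine ⟨fun z => u (z + t), ?_, (tendsto_add_const_punctured α t).eventually hFu⟩
  exact AnalyticAt.fun_comp (f := fun z : ℂ => z + t) hu (analyticAt_id.add analyticAt_const)

theorem ExtAnalyticAt.of_comp_add_const {F : ℂ → ℂ} {α t : ℂ}
    (h : ExtAnalyticAt (fun z => F (z + t)) α) : ExtAnalyticAt F (α + t) := by
  have h' : ExtAnalyticAt (fun z => F (z + t)) (α + t + -t) := by simpa using h
  simpa using h'.comp_add_const

theorem AnalyticAt.extAnalyticAt {F : ℂ → ℂ} {α : ℂ} (h : AnalyticAt ℂ F α) :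
    ExtAnalyticAt F α :=
  ⟨F, h, Eventually.of_forall fun _ => rfl⟩

end ExtAnalytic

section PrincipalPart

theorem IsPrincPart.extAnalyticAt {f : ℂ → ℂ} {α : ℂ} {c : ℕ → ℂ} (h : IsPrincPart f α c)
    (hc : ∀ k, 1 ≤ k → c k = 0) : ExtAnalyticAt f α := by
  obtain ⟨h₀, -, h⟩ := h
  have hc' : ∀ k, c k = 0 := fun k => by
    rcases Nat.eq_zero_or_pos k with rfl | hk
    exacts [h₀, hc k hk]
  simpa [hc'] using h

/-- A finite sum of negative powers of `z - α` with an analytic extension to `α` is trivial. -/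
theorem eq_zero_of_extAnalyticAt_negPowers {α : ℂ} {c : ℕ → ℂ} (h₀ : c 0 = 0)
    (hfin : (Function.support c).Finite)
    (h : ExtAnalyticAt (fun z => ∑ᶠ k : ℕ, c k / (z - α) ^ k) α) (k : ℕ) : c k = 0 := by
  classical
  by_contra hk
  obtain ⟨u, hu, hcu⟩ := h
  have hne : hfin.toFinset.Nonempty := ⟨k, by simpa using hk⟩
  obtain ⟨N, hN, hmax⟩ : ∃ N, c N ≠ 0 ∧ ∀ j, c j ≠ 0 → j ≤ N :=
    ⟨hfin.toFinset.max' hne, by simpa using hfin.toFinset.max'_mem hne,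
      fun j hj => hfin.toFinset.le_max' j (by simpa using hj)⟩
  have hN0 : N ≠ 0 := fun h => hN (h ▸ h₀)
  have hsum : ∀ᶠ z in 𝓝[≠] α,
      ∑ j ∈ Finset.range (N + 1), c j * (z - α) ^ (N - j) = u z * (z - α) ^ N := by
    filter_upwards [hcu, self_mem_nhdsWithin] with z hz hzα
    have hzα' : z - α ≠ 0 := sub_ne_zero.mpr hzα
    rw [← hz, finsum_eq_sum_of_support_subset (s := Finset.range (N + 1)), Finset.sum_mul]
    · refine Finset.sum_congr rfl fun j hj => ?_
      have hj' : j ≤ N := Nat.lt_succ_iff.mp (Finset.mem_range.mp hj)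
      rw [← Nat.sub_add_cancel hj', pow_add, Nat.add_sub_cancel]
      field_simp
    · intro j hj
      have : c j ≠ 0 := fun h => hj (by simp [h])
      simpa [Nat.lt_succ_iff] using hmax j this
  have hl : Tendsto (fun z => ∑ j ∈ Finset.range (N + 1), c j * (z - α) ^ (N - j))
      (𝓝[≠] α) (𝓝 (c N)) := by
    have hcont : Continuous fun z : ℂ =>
        ∑ j ∈ Finset.range (N + 1), c j * (z - α) ^ (N - j) := by fun_prop
    have hval : ∑ j ∈ Finset.range (N + 1), c j * (α - α) ^ (N - j) = c N := by
      rw [Finset.sum_range_succ, Finset.sum_eq_zero]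
      · simp
      · intro j hj
        have : N - j ≠ 0 := (Nat.sub_pos_of_lt (Finset.mem_range.mp hj)).ne'
        simp [this]
    simpa only [hval] using (hcont.tendsto α).mono_left nhdsWithin_le_nhds
  have hr : Tendsto (fun z => u z * (z - α) ^ N) (𝓝[≠] α) (𝓝 0) := by
    have hcont : ContinuousAt (fun z => u z * (z - α) ^ N) α :=
      hu.continuousAt.mul (by fun_prop)
    simpa [hN0] using hcont.tendsto.mono_left nhdsWithin_le_nhds
  exact hN (tendsto_nhds_unique (hl.congr' hsum) hr)

theorem IsPrincPart.eq_zero {f : ℂ → ℂ} {α : ℂ} {c : ℕ → ℂ} (h : IsPrincPart f α c)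
    (hf : ExtAnalyticAt f α) (k : ℕ) : c k = 0 := by
  obtain ⟨h₀, hfin, h⟩ := h
  exact eq_zero_of_extAnalyticAt_negPowers h₀ hfin (by simpa using hf.sub h) k

end PrincipalPart

section Lattice

theorem IsLattice.add_mem {L : Set ℂ} (hL : IsLattice L) {x y : ℂ} (hx : x ∈ L) (hy : y ∈ L) :
    x + y ∈ L := by
  obtain ⟨ω₁, ω₂, -, rfl⟩ := hL
  obtain ⟨m, n, rfl⟩ := hx
  obtain ⟨m', n', rfl⟩ := hy
  exact ⟨m + m', n + n', by push_cast; ring⟩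

theorem IsLattice.neg_mem {L : Set ℂ} (hL : IsLattice L) {x : ℂ} (hx : x ∈ L) : -x ∈ L := by
  obtain ⟨ω₁, ω₂, -, rfl⟩ := hL
  obtain ⟨m, n, rfl⟩ := hx
  exact ⟨-m, -n, by push_cast; ring⟩

theorem IsLattice.zero_mem {L : Set ℂ} (hL : IsLattice L) : (0 : ℂ) ∈ L := by
  obtain ⟨ω₁, ω₂, -, rfl⟩ := hL
  exact ⟨0, 0, by simp⟩

/-- Translates of a suitable compact set by the lattice cover the plane. -/
theorem IsLattice.exists_isCompact {L : Set ℂ} (hL : IsLattice L) :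
    ∃ K : Set ℂ, IsCompact K ∧ ∀ z : ℂ, ∃ lam ∈ L, z + lam ∈ K := by
  obtain ⟨ω₁, ω₂, hli, rfl⟩ := hL
  refine ⟨(fun p : ℝ × ℝ => (p.1 : ℂ) * ω₁ + (p.2 : ℂ) * ω₂) '' (Icc 0 1 ×ˢ Icc 0 1),
    (isCompact_Icc.prod isCompact_Icc).image (by fun_prop), fun z => ?_⟩
  have hz : z ∈ Submodule.span ℝ (Set.range ![ω₁, ω₂]) := by
    rw [hli.span_eq_top_of_card_eq_finrank' (by simp)]
    trivial
  rw [Matrix.range_cons_cons_empty, Submodule.mem_span_pair] at hz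
  obtain ⟨a, b, rfl⟩ := hz
  refine ⟨(-⌊a⌋ : ℤ) * ω₁ + (-⌊b⌋ : ℤ) * ω₂, ⟨-⌊a⌋, -⌊b⌋, rfl⟩, (Int.fract a, Int.fract b),
    ⟨⟨Int.fract_nonneg a, (Int.fract_lt_one a).le⟩,
      ⟨Int.fract_nonneg b, (Int.fract_lt_one b).le⟩⟩, ?_⟩
  simp only [Int.fract, Complex.real_smul]
  push_cast
  ring

end Lattice

section Elliptic

theorem IsElliptic.extAnalyticAt_add {L : Set ℂ} {g : ℂ → ℂ} (hg : IsElliptic L g) {α lam : ℂ}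
    (hlam : lam ∈ L) (h : ExtAnalyticAt g α) : ExtAnalyticAt g (α + lam) := by
  refine ExtAnalyticAt.of_comp_add_const (h.congr ?_)
  filter_upwards [(hg.1 α (mem_univ α)).eventually_analyticAt] with z hz
  exact hg.2 lam hlam z hz

/-- An elliptic function has no pole at some point of a progression whose step has infinite
order modulo the lattice. -/
theorem IsElliptic.exists_extAnalyticAt {L : Set ℂ} (hL : IsLattice L) {g : ℂ → ℂ}
    (hg : IsElliptic L g) {t : ℂ} (ht : ∀ n : ℕ, 1 ≤ n → (n : ℂ) * t ∉ L) (w : ℂ) :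
    ∃ n : ℕ, ExtAnalyticAt g (w + n * t) := by
  by_contra! hpole
  obtain ⟨K, hK, hcov⟩ := hL.exists_isCompact
  choose lam hlam hmem using fun n : ℕ => hcov (w + n * t)
  have hinj : Function.Injective fun n : ℕ => w + n * t + lam n := by
    refine Function.Injective.of_lt_imp_ne fun m n hmn heq => ht (n - m) (by omega) ?_
    have hdiff : ((n - m : ℕ) : ℂ) * t = lam m + -lam n := by
      rw [Nat.cast_sub hmn.le]
      linear_combination -heq
    rw [hdiff]
    exact hL.add_mem (hlam m) (hL.neg_mem (hlam n))
  obtain ⟨p, -, hp⟩ := (infinite_range_of_injective hinj).exists_accPt_of_subset_isCompact hK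
    (range_subset_iff.mpr hmem)
  obtain ⟨x, ⟨n, rfl⟩, hx⟩ := ((accPt_iff_frequently_nhdsNE.mp hp).and_eventually
    (hg.1 p (mem_univ p)).eventually_analyticAt).exists
  refine hpole n ?_
  simpa using hg.extAnalyticAt_add (hL.neg_mem (hlam n)) hx.extAnalyticAt

theorem eventually_eq_sub_of_isElliptic {L : Set ℂ} {g f : ℂ → ℂ} {s : ℂ} (hg : IsElliptic L g)
    (hfg : ∀ z : ℂ, AnalyticAt ℂ g z → AnalyticAt ℂ g (z + s) → f z = g (z + s) - g z) (α : ℂ) :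
    ∀ᶠ z in 𝓝[≠] α, f z = g (z + s) - g z := by
  filter_upwards [(hg.1 α (mem_univ α)).eventually_analyticAt,
    (tendsto_add_const_punctured α s).eventually
      (hg.1 (α + s) (mem_univ _)).eventually_analyticAt] with z h₁ h₂
  exact hfg z h₁ h₂

end Elliptic

theorem stmt11 (L : Set ℂ) (hL : IsLattice L) (s : ℂ)
    (hs : ∀ n : ℕ, 1 ≤ n → (n : ℂ) * s ∉ L)
    (f : ℂ → ℂ) (hf : IsElliptic L f) (hsum : EllSummable L s f)
    (c : ℂ → ℕ → ℂ) (hc : ∀ α : ℂ, IsPrincPart f α (c α))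
    (z₀ : ℂ) (hz₀ : ∃ k : ℕ, 1 ≤ k ∧ c z₀ k ≠ 0) :
    ∃ n : ℤ, ∃ lam ∈ L,
      (∀ mu ∈ L, z₀ + (n : ℂ) * s + lam ≠ z₀ + mu) ∧
      ∃ k : ℕ, 1 ≤ k ∧ c (z₀ + (n : ℂ) * s + lam) k ≠ 0 := by
  obtain ⟨g, hg, hfg⟩ := hsum
  have hev := eventually_eq_sub_of_isElliptic hg hfg
  by_contra! hcon
  have hns : ∀ n : ℤ, n ≠ 0 → (n : ℂ) * s ∉ L := by
    intro n hn hmem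
    rcases Int.natAbs_eq n with h | h
    · refine hs n.natAbs (Int.natAbs_pos.mpr hn) ?_
      rw [h] at hmem
      simpa using hmem
    · refine hs n.natAbs (Int.natAbs_pos.mpr hn) ?_
      rw [h] at hmem
      simpa using hL.neg_mem hmem
  have hfn : ∀ n : ℤ, n ≠ 0 → ExtAnalyticAt f (z₀ + n * s) := by
    intro n hn
    refine (hc _).extAnalyticAt fun k hk => ?_
    simpa using hcon n 0 hL.zero_mem
      (fun mu hmu heq => hns n hn (by rw [add_zero, add_right_inj] at heq; rwa [heq]))
      k hk
  have hdown : ∀ n : ℤ, n ≠ 0 → ExtAnalyticAt g (z₀ + n * s + s) →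
      ExtAnalyticAt g (z₀ + n * s) := fun n hn h =>
    (h.comp_add_const.sub (hfn n hn)).congr ((hev _).mono fun z hz => by rw [hz]; ring)
  have hup : ∀ n : ℤ, n ≠ 0 → ExtAnalyticAt g (z₀ + n * s) →
      ExtAnalyticAt g (z₀ + n * s + s) := fun n hn h =>
    ExtAnalyticAt.of_comp_add_const
      (((hfn n hn).add h).congr ((hev _).mono fun z hz => by rw [hz]; ring))
  have hright : ∀ n : ℕ, ExtAnalyticAt g (z₀ + s + n * s) → ExtAnalyticAt g (z₀ + s) := by
    intro n
    induction n with
    | zero => intro h; simpa using h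
    | succ n ih =>
      intro h
      have := hdown (n + 1) (by omega) (by convert h using 1; push_cast; ring)
      exact ih (by convert this using 1; push_cast; ring)
  have hleft : ∀ n : ℕ, ExtAnalyticAt g (z₀ + n * -s) → ExtAnalyticAt g z₀ := by
    intro n
    induction n with
    | zero => intro h; simpa using h
    | succ n ih =>
      intro h
      have := hup (-(n + 1)) (by omega) (by convert h using 1; push_cast; ring)
      exact ih (by convert this using 1; push_cast; ring)
  obtain ⟨a, ha⟩ := hg.exists_extAnalyticAt hL hs (z₀ + s)
  obtain ⟨b, hb⟩ := hg.exists_extAnalyticAt hL (t := -s)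
    (fun n hn h => hs n hn (by simpa using hL.neg_mem h)) z₀
  obtain ⟨k, -, hk⟩ := hz₀
  exact hk ((hc z₀).eq_zero
    (((hright a ha).comp_add_const.sub (hleft b hb)).congr (hev z₀)) k)
end
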